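/- Let P = ℝ[x_{μν} : 1 ≤ μ < ν ≤ n] be the polynomial algebra, with x_{νμ} := -x_{μν}, x_{μμ} := 0, let ∂_{μν} (∂_{νμ} = -∂_{μν}) denote partial differentiation with respect to x_{μν}, and let x_{μν} also denote the corresponding multiplication operator on P. Define the operators K_{(μν)(αβ)} = (1/2)(δ_{μα}∂_{νβ} - δ_{μβ}∂_{να} + δ_{νβ}∂_{μα} - δ_{να}∂_{μβ}) with powers (K⁰)_{(μν)(αβ)} = (1/2)(δ_{μα}δ_{νβ} - δ_{μβ}δ_{να})·id, (K^m) = Σ_{θ,σ} K_{(μν)(θσ)} ∘ (K^{m-1})_{(θσ)(αβ)}, and the locally finite sum ψ(K)_{(μν)(αβ)} = Σ_{k≥0} ((-1)^k B_k/k!) (K^k)_{(μν)(αβ)} (well defined as a linear operator on P since each ∂_{μν} strictly lowers polynomial degree). Then the operators M̂_{μν} = Σ_{α,β=1}^n x_{αβ} ∘ ψ(K)_{(μν)(αβ)} satisfy the so(n) commutation relations: [M̂_{μν}, M̂_{λρ}] = δ_{νλ} M̂_{μρ} - δ_{μλ} M̂_{νρ} - δ_{νρ} M̂_{μλ} + δ_{μρ}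 M̂_{νλ} for all 1 ≤ μ,ν,λ,ρ ≤ n. -/

import Mathlib

open MvPolynomial

/-- Index set for the variables `x_{μν}`, `1 ≤ μ < ν ≤ n`. -/
abbrev PairIdx (n : ℕ) := {q : Fin n × Fin n // q.1 < q.2}

/-- The polynomial algebra `P = ℝ[x_{μν} : 1 ≤ μ < ν ≤ n]`. -/
abbrev PolyH (n : ℕ) := MvPolynomial (PairIdx n) ℝ

/-- Kronecker delta. -/
def kd {n : ℕ} (a b : Fin n) : ℝ := if a = b then 1 else 0

/-- The antisymmetric family of variables: `x_{νμ} = -x_{μν}`, `x_{μμ} = 0`. -/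
noncomputable def xv {n : ℕ} (μ ν : Fin n) : PolyH n :=
  if h : μ < ν then X ⟨(μ, ν), h⟩ else if h : ν < μ then - X ⟨(ν, μ), h⟩ else 0

/-- Multiplication operator by `x_{μν}` on `P`. -/
noncomputable def xop {n : ℕ} (μ ν : Fin n) : PolyH n → PolyH n := fun p => xv μ ν * p

/-- Partial differentiation `∂_{μν} = ∂/∂x_{μν}`, antisymmetric: `∂_{νμ} = -∂_{μν}`. -/
noncomputable def dop {n : ℕ} (μ ν : Fin n) : PolyH n → PolyH n := fun p =>
  if h : μ < ν then pderiv ⟨(μ, ν), h⟩ p else if h : ν < μ then - pderiv ⟨(ν, μ), h⟩ p else 0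

/-- The operator `K_{(μν)(αβ)} = (1/2)(δ_{μα}∂_{νβ} - δ_{μβ}∂_{να} + δ_{νβ}∂_{μα} - δ_{να}∂_{μβ})`. -/
noncomputable def Kop {n : ℕ} (μ ν α β : Fin n) : PolyH n → PolyH n := fun p =>
  (1/2 : ℝ) • (kd μ α • dop ν β p - kd μ β • dop ν α p + kd ν β • dop μ α p - kd ν α • dop μ β p)

/-- Powers of `K`: `(K⁰)_{(μν)(αβ)} = (1/2)(δ_{μα}δ_{νβ} - δ_{μβ}δ_{να})·id` and
`(K^m)_{(μν)(αβ)} = Σ_{θ,σ} K_{(μν)(θσ)}(K^{m-1})_{(θσ)(αβ)}`. -/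
noncomputable def Kpow {n : ℕ} : ℕ → Fin n → Fin n → Fin n → Fin n → (PolyH n → PolyH n)
  | 0 => fun μ ν α β p => ((1/2 : ℝ) * (kd μ α * kd ν β - kd μ β * kd ν α)) • p
  | m+1 => fun μ ν α β p => ∑ θ, ∑ σ, Kop μ ν θ σ (Kpow m θ σ α β p)

/-- The coefficient `(-1)^k B_k / k!` of the generating function `ψ(t) = t/(1-e^{-t})`
of the Bernoulli numbers (`B₁ = -1/2`, i.e. Mathlib's `bernoulli`). -/
noncomputable def bcoef (k : ℕ) : ℝ := (-1 : ℝ)^k * ((bernoulli k : ℚ) : ℝ) / (k.factorial : ℝ)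

/-- `ψ(K)_{(μν)(αβ)} = Σ_{k≥0} ((-1)^k B_k/k!)(K^k)_{(μν)(αβ)}`, a locally finite sum. -/
noncomputable def psiK {n : ℕ} (μ ν α β : Fin n) : PolyH n → PolyH n := fun p =>
  ∑ᶠ k : ℕ, bcoef k • Kpow k μ ν α β p

/-- The Weyl realization `M̂_{μν} = Σ_{α,β} x_{αβ} ∘ ψ(K)_{(μν)(αβ)}`. -/
noncomputable def Mhat {n : ℕ} (μ ν : Fin n) : PolyH n → PolyH n := fun p =>
  ∑ α, ∑ β, xv α β * psiK μ ν α β p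

/-- The algebra of differential operators generated by the partial derivatives. -/
noncomputable def pderivSubalgebra (σ : Type*) :
    Subalgebra ℝ (Module.End ℝ (MvPolynomial σ ℝ)) :=
  Algebra.adjoin ℝ (Set.range fun i : σ =>
    ((pderiv i : Derivation ℝ (MvPolynomial σ ℝ) (MvPolynomial σ ℝ)) :
      Module.End ℝ (MvPolynomial σ ℝ)))

lemma pderiv_comm {σ : Type*} (i j : σ) (p : MvPolynomial σ ℝ) :
    pderiv i (pderiv j p) = pderiv j (pderiv i p) := by
  classical
  have h : ⁅(pderiv i : Derivation ℝ (MvPolynomial σ ℝ) (MvPolynomial σ ℝ)),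
      (pderiv j : Derivation ℝ (MvPolynomial σ ℝ) (MvPolynomial σ ℝ))⁆ = 0 := by
    ext k : 1
    simp [Derivation.commutator_apply, pderiv_X, Pi.single_apply, apply_ite]
  rw [← sub_eq_zero, ← Derivation.commutator_apply, h, Derivation.zero_apply]

instance (σ : Type*) : IsMulCommutative (pderivSubalgebra σ) :=
  Algebra.isMulCommutative_adjoin ℝ (by
    rintro _ ⟨i, rfl⟩ _ ⟨j, rfl⟩
    exact LinearMap.ext (pderiv_comm i j))

open scoped IsMulCommutative in
/-- The constant-coefficient differential operator `f(∂)` with symbol `f`. -/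
noncomputable def constCoeffOp (σ : Type*) :
    MvPolynomial σ ℝ →ₐ[ℝ] Module.End ℝ (MvPolynomial σ ℝ) :=
  (pderivSubalgebra σ).val.comp
    (aeval (S₁ := pderivSubalgebra σ) fun i => ⟨_, Algebra.subset_adjoin ⟨i, rfl⟩⟩)

lemma constCoeffOp_X {σ : Type*} (i : σ) (p : MvPolynomial σ ℝ) :
    constCoeffOp σ (X i) p = pderiv i p := by
  simp [constCoeffOp]

lemma constCoeffOp_C {σ : Type*} (a : ℝ) (p : MvPolynomial σ ℝ) :
    constCoeffOp σ (C a) p = a • p := by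
  rw [← algebraMap_eq, AlgHom.commutes]; rfl

lemma constCoeffOp_mul_apply {σ : Type*} (f g p : MvPolynomial σ ℝ) :
    constCoeffOp σ (f * g) p = constCoeffOp σ f (constCoeffOp σ g p) := by
  rw [map_mul, Module.End.mul_apply]

lemma constCoeffOp_X_mul {σ : Type*} (f : MvPolynomial σ ℝ) (i : σ) (p : MvPolynomial σ ℝ) :
    constCoeffOp σ f (X i * p) =
      X i * constCoeffOp σ f p + constCoeffOp σ (pderiv i f) p := by
  classical
  induction f using MvPolynomial.induction_on generalizing p with
  | C a => simp
  | add f g hf hg => simp only [map_add, LinearMap.add_apply, hf, hg]; ring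
  | mul_X f j hf =>
    have h : pderiv i (f * X j) = pderiv i f * X j + f * pderiv i (X j) := by
      rw [Derivation.leibniz, smul_eq_mul, smul_eq_mul]; ring
    rw [h, map_add, LinearMap.add_apply]
    simp only [constCoeffOp_mul_apply, constCoeffOp_X, Derivation.leibniz, smul_eq_mul,
      map_add, hf]
    rcases eq_or_ne i j with rfl | h
    · simp only [pderiv_X_self, mul_one, map_one, Module.End.one_apply]
      ring
    · simp [pderiv_X_of_ne h, pderiv_X_of_ne h.symm]

lemma constCoeffOp_of_isHomogeneous_of_lt {σ : Type*} [Fintype σ] {f p : MvPolynomial σ ℝ}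
    {d e : ℕ} (hf : f.IsHomogeneous d) (hp : p.IsHomogeneous e) (h : e < d) :
    constCoeffOp σ f p = 0 := by
  induction d generalizing e f p with
  | zero => omega
  | succ d ih =>
    have hE := congrArg (fun g => constCoeffOp σ g p) hf.sum_X_mul_pderiv
    simp only [map_sum, LinearMap.sum_apply, map_nsmul, LinearMap.smul_apply] at hE
    have h0 : ∀ i, constCoeffOp σ (X i * pderiv i f) p = 0 := by
      intro i
      rw [mul_comm, constCoeffOp_mul_apply, constCoeffOp_X]
      rcases e with _ | e
      · rw [totalDegree_eq_zero_iff_eq_C.1 (Nat.le_zero.1 hp.totalDegree_le)]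
        simp
      · exact ih hf.pderiv hp.pderiv (by omega)
    rw [Finset.sum_eq_zero fun i _ => h0 i] at hE
    exact (smul_eq_zero.1 hE.symm).resolve_left (by omega)

lemma constCoeffOp_of_totalDegree_lt {σ : Type*} [Fintype σ] {f p : MvPolynomial σ ℝ} {d : ℕ}
    (hf : f.IsHomogeneous d) (hp : p.totalDegree < d) :
    constCoeffOp σ f p = 0 := by
  rw [← sum_homogeneousComponent p, map_sum]
  refine Finset.sum_eq_zero fun i hi => ?_
  exact constCoeffOp_of_isHomogeneous_of_lt hf (homogeneousComponent_isHomogeneous i p)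
    (by have := Finset.mem_range.1 hi; omega)

lemma rescale_bernoulli'PowerSeries_mul (A : Type*) [CommRing A] [Algebra ℚ A] (a : A) :
    PowerSeries.rescale a (bernoulli'PowerSeries A) *
        (1 - PowerSeries.rescale (-a) (PowerSeries.exp A)) =
      PowerSeries.C a * PowerSeries.X := by
  have h := bernoulli'PowerSeries_mul_exp_sub_one A
  have h2 := PowerSeries.exp_mul_exp_neg_eq_one (A := A)
  rw [← PowerSeries.rescale_X, ← map_one (PowerSeries.rescale a), ← mul_neg_one,
    mul_comm a (-1), PowerSeries.rescale_mul, RingHom.comp_apply, ← map_sub, ← map_mul]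
  congr 1
  unfold PowerSeries.evalNegHom at h2
  linear_combination PowerSeries.rescale (-1) (PowerSeries.exp A) * h +
    (PowerSeries.X - bernoulli'PowerSeries A) * h2

/-- The power series form of `s ψ(t) ψ(s+t) + t ψ(s) ψ(s+t) - (s+t) ψ(s) ψ(t) = s t ψ(s+t)`. -/
lemma bernoulli'PowerSeries_addition (A : Type*) [CommRing A] [IsDomain A] [Algebra ℚ A]
    {s t : A} (hs : s ≠ 0) (ht : t ≠ 0) (hst : s + t ≠ 0) :
    PowerSeries.C s * (PowerSeries.rescale (s + t) (bernoulli'PowerSeries A) *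
          PowerSeries.rescale t (bernoulli'PowerSeries A)) +
        PowerSeries.C t * (PowerSeries.rescale s (bernoulli'PowerSeries A) *
          PowerSeries.rescale (s + t) (bernoulli'PowerSeries A)) -
        PowerSeries.C (s + t) * (PowerSeries.rescale s (bernoulli'PowerSeries A) *
          PowerSeries.rescale t (bernoulli'PowerSeries A)) =
      PowerSeries.C (s * t) *
        (PowerSeries.rescale (s + t) (bernoulli'PowerSeries A) * PowerSeries.X) := by
  have hp := rescale_bernoulli'PowerSeries_mul A s
  have hq := rescale_bernoulli'PowerSeries_mul A t
  have hr := rescale_bernoulli'PowerSeries_mul A (s + t)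
  have hE : PowerSeries.rescale (-(s + t)) (PowerSeries.exp A) =
      PowerSeries.rescale (-s) (PowerSeries.exp A) *
        PowerSeries.rescale (-t) (PowerSeries.exp A) := by
    rw [PowerSeries.exp_mul_exp_eq_exp_add, neg_add]
  rw [hE] at hr
  generalize PowerSeries.rescale (-s) (PowerSeries.exp A) = S at *
  generalize PowerSeries.rescale (-t) (PowerSeries.exp A) = T at *
  generalize PowerSeries.rescale (s + t) (bernoulli'PowerSeries A) = r at *
  generalize PowerSeries.rescale s (bernoulli'PowerSeries A) = p at *
  generalize PowerSeries.rescale t (bernoulli'PowerSeries A) = q at *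
  have hne : ∀ a : A, a ≠ 0 → (PowerSeries.C a * PowerSeries.X : PowerSeries A) ≠ 0 := by
    intro a ha
    refine mul_ne_zero (fun h => ha ?_) PowerSeries.X_ne_zero
    exact PowerSeries.C_injective (by rw [h, map_zero])
  have hS : (1 - S) ≠ 0 := right_ne_zero_of_mul (hp ▸ hne s hs)
  have hT : (1 - T) ≠ 0 := right_ne_zero_of_mul (hq ▸ hne t ht)
  have hST : (1 - S * T) ≠ 0 := right_ne_zero_of_mul (hr ▸ hne _ hst)
  refine mul_right_cancel₀ (mul_ne_zero (mul_ne_zero hS hT) hST) ?_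
  simp only [map_mul, map_add] at hr ⊢
  linear_combination PowerSeries.C s * (1 - S) *
      (r * (1 - S * T) * hq + PowerSeries.C t * PowerSeries.X * hr) +
    PowerSeries.C t * (1 - T) * (r * (1 - S * T) * hp + PowerSeries.C s * PowerSeries.X * hr) -
    (PowerSeries.C s + PowerSeries.C t) * (1 - S * T) *
      (q * (1 - T) * hp + PowerSeries.C s * PowerSeries.X * hq) -
    PowerSeries.C s * PowerSeries.C t * PowerSeries.X * (1 - S) * (1 - T) * hr

lemma coeff_bernoulli'PowerSeries_eq_bcoef {A : Type*} [CommRing A] [Algebra ℚ A] [Algebra ℝ A]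
    (k : ℕ) : PowerSeries.coeff k (bernoulli'PowerSeries A) = algebraMap ℝ A (bcoef k) := by
  rw [bernoulli'PowerSeries, PowerSeries.coeff_mk, bernoulli'_eq_bernoulli, bcoef]
  have : algebraMap ℚ A = (algebraMap ℝ A).comp (algebraMap ℚ ℝ) := Subsingleton.elim _ _
  rw [this, RingHom.comp_apply]
  simp

/-- The homogeneous components of the addition formula for `ψ`, with the divided differences
expanded. -/
lemma bcoef_addition (m : ℕ) :
    ∑ kl ∈ Finset.HasAntidiagonal.antidiagonal (m + 1), (bcoef kl.1 * bcoef kl.2) •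
      ((∑ i ∈ Finset.range kl.1, (X 0 + X 1 : MvPolynomial (Fin 2) ℝ) ^ i *
          (X 0 ^ (kl.1 - 1 - i) * X 1 ^ kl.2)) +
        ∑ i ∈ Finset.range kl.2, (X 0 + X 1 : MvPolynomial (Fin 2) ℝ) ^ i *
          (X 0 ^ kl.1 * X 1 ^ (kl.2 - 1 - i))) =
      bcoef m • (X 0 + X 1) ^ m := by
  set s : MvPolynomial (Fin 2) ℝ := X 0 with hs'
  set t : MvPolynomial (Fin 2) ℝ := X 1 with ht'
  have hs : s ≠ 0 := X_ne_zero 0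
  have ht : t ≠ 0 := X_ne_zero 1
  have hst : s + t ≠ 0 := by
    intro h
    have := congrArg (MvPolynomial.eval fun _ => (1 : ℝ)) h
    simp [hs', ht'] at this
  have key := congrArg (PowerSeries.coeff (m + 1))
    (bernoulli'PowerSeries_addition (MvPolynomial (Fin 2) ℝ) hs ht hst)
  simp only [map_sub, map_add (PowerSeries.coeff (R := MvPolynomial (Fin 2) ℝ) (m + 1)),
    PowerSeries.coeff_C_mul, PowerSeries.coeff_succ_mul_X] at key
  simp only [PowerSeries.coeff_mul, PowerSeries.coeff_rescale,
    coeff_bernoulli'PowerSeries_eq_bcoef, Finset.mul_sum] at key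
  rw [← Finset.sum_add_distrib, ← Finset.sum_sub_distrib] at key
  refine mul_left_cancel₀ (mul_ne_zero hs ht) ?_
  rw [Finset.mul_sum, Algebra.smul_def (bcoef m), mul_comm (algebraMap _ _ (bcoef m)), ← key]
  refine Finset.sum_congr rfl fun kl _ => ?_
  obtain ⟨k, l⟩ := kl
  have h1 := geom_sum₂_mul (s + t) s k
  have h2 := geom_sum₂_mul (s + t) t l
  have e1 : ∑ i ∈ Finset.range k, (s + t) ^ i * (s ^ (k - 1 - i) * t ^ l) =
      (∑ i ∈ Finset.range k, (s + t) ^ i * s ^ (k - 1 - i)) * t ^ l := by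
    simp only [Finset.sum_mul, mul_assoc]
  have e2 : ∑ i ∈ Finset.range l, (s + t) ^ i * (s ^ k * t ^ (l - 1 - i)) =
      (∑ i ∈ Finset.range l, (s + t) ^ i * t ^ (l - 1 - i)) * s ^ k := by
    simp only [Finset.sum_mul]
    exact Finset.sum_congr rfl fun i _ => by ring
  simp only [e1, e2, Algebra.smul_def, map_mul]
  linear_combination algebraMap ℝ (MvPolynomial (Fin 2) ℝ) (bcoef k) *
    algebraMap ℝ (MvPolynomial (Fin 2) ℝ) (bcoef l) * (s * t ^ l * h1 + t * s ^ k * h2)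

section Bracket

variable {M : Type*} [AddCommGroup M] [Module ℝ M] [Bracket M M]

/-- `f(s, t) ↦ [·,·] ∘ f(T ⊗ 1, 1 ⊗ T) (A ⊗ B)`. -/
noncomputable def bracketEval (T : Module.End ℝ M) (A B : M) : MvPolynomial (Fin 2) ℝ →ₗ[ℝ] M :=
  (basisMonomials (Fin 2) ℝ).constr ℝ fun d => ⁅(T ^ d 0) A, (T ^ d 1) B⁆

lemma bracketEval_monomial (T : Module.End ℝ M) (A B : M) (d : Fin 2 →₀ ℕ) :
    bracketEval T A B (monomial d 1) = ⁅(T ^ d 0) A, (T ^ d 1) B⁆ := by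
  simpa [bracketEval] using (basisMonomials (Fin 2) ℝ).constr_basis ℝ
    (fun d => ⁅(T ^ d 0) A, (T ^ d 1) B⁆) d

lemma bracketEval_X_pow_mul_X_pow (T : Module.End ℝ M) (A B : M) (j l : ℕ) :
    bracketEval T A B (X 0 ^ j * X 1 ^ l) = ⁅(T ^ j) A, (T ^ l) B⁆ := by
  rw [X_pow_eq_monomial, X_pow_eq_monomial, monomial_mul, one_mul, bracketEval_monomial]
  simp

lemma bracketEval_add_mul {T : Module.End ℝ M} (hT : ∀ a b, T ⁅a, b⁆ = ⁅T a, b⁆ + ⁅a, T b⁆)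
    (A B : M) (f : MvPolynomial (Fin 2) ℝ) :
    bracketEval T A B ((X 0 + X 1) * f) = T (bracketEval T A B f) := by
  have : bracketEval T A B ∘ₗ LinearMap.mulLeft ℝ (X 0 + X 1) = T ∘ₗ bracketEval T A B := by
    refine (basisMonomials (Fin 2) ℝ).ext fun d => ?_
    simp only [coe_basisMonomials, LinearMap.comp_apply, LinearMap.mulLeft_apply, add_mul,
      map_add, X, monomial_mul, one_mul, bracketEval_monomial, hT]
    simp [pow_add]
  exact LinearMap.congr_fun this f

lemma bracketEval_add_pow_mul {T : Module.End ℝ M} (hT : ∀ a b, T ⁅a, b⁆ = ⁅T a, b⁆ + ⁅a, T b⁆)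
    (A B : M) (i : ℕ) (f : MvPolynomial (Fin 2) ℝ) :
    bracketEval T A B ((X 0 + X 1) ^ i * f) = (T ^ i) (bracketEval T A B f) := by
  induction i with
  | zero => simp
  | succ i ih => rw [pow_succ', mul_assoc, bracketEval_add_mul hT, ih, pow_succ',
      Module.End.mul_apply]

lemma bcoef_bracket_addition {T : Module.End ℝ M} (hT : ∀ a b, T ⁅a, b⁆ = ⁅T a, b⁆ + ⁅a, T b⁆)
    (A B : M) (m : ℕ) :
    ∑ kl ∈ Finset.HasAntidiagonal.antidiagonal (m + 1), (bcoef kl.1 * bcoef kl.2) •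
      ((∑ i ∈ Finset.range kl.1, (T ^ i) ⁅(T ^ (kl.1 - 1 - i)) A, (T ^ kl.2) B⁆) +
        ∑ i ∈ Finset.range kl.2, (T ^ i) ⁅(T ^ kl.1) A, (T ^ (kl.2 - 1 - i)) B⁆) =
      bcoef m • (T ^ m) ⁅A, B⁆ := by
  have h := congrArg (bracketEval T A B) (bcoef_addition m)
  simp only [map_sum, map_smul, map_add, bracketEval_add_pow_mul hT,
    bracketEval_X_pow_mul_X_pow] at h
  rw [h, ← mul_one ((X 0 + X 1 : MvPolynomial (Fin 2) ℝ) ^ m), bracketEval_add_pow_mul hT]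
  simpa using congrArg (fun f => bcoef m • (T ^ m) f) (bracketEval_X_pow_mul_X_pow T A B 0 0)

end Bracket

section Weyl

variable {n : ℕ}

/-- The operator `dop μ ν` as a derivation. -/
noncomputable def dder (μ ν : Fin n) : Derivation ℝ (PolyH n) (PolyH n) :=
  if h : μ < ν then pderiv ⟨(μ, ν), h⟩ else if h : ν < μ then - pderiv ⟨(ν, μ), h⟩ else 0

lemma xv_swap (μ ν : Fin n) : xv ν μ = -xv μ ν := by
  unfold xv
  split_ifs with h1 h2 <;> first | simp | exact absurd h1 h2.asymm

lemma isHomogeneous_xv (μ ν : Fin n) : (xv μ ν).IsHomogeneous 1 := by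
  unfold xv
  split_ifs
  · exact isHomogeneous_X _ _
  · exact (isHomogeneous_X _ _).neg
  · exact isHomogeneous_zero _ _ _

lemma constCoeffOp_xv (μ ν : Fin n) (p : PolyH n) :
    constCoeffOp _ (xv μ ν) p = dop μ ν p := by
  unfold dop xv
  split_ifs <;> simp [constCoeffOp_X]

lemma constCoeffOp_xv_mul (f : PolyH n) (μ ν : Fin n) (p : PolyH n) :
    constCoeffOp _ f (xv μ ν * p) =
      xv μ ν * constCoeffOp _ f p + constCoeffOp _ (dder μ ν f) p := by
  unfold xv dder
  split_ifs
  · exact constCoeffOp_X_mul f _ p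
  · rw [neg_mul, map_neg, constCoeffOp_X_mul, Derivation.neg_apply, map_neg]
    simp only [LinearMap.neg_apply]
    ring
  · simp

lemma dder_xv (γ δ α β : Fin n) :
    dder γ δ (xv α β) = C (kd γ α * kd δ β - kd γ β * kd δ α) := by
  unfold dder xv kd
  rcases lt_trichotomy γ δ with h | h | h <;> rcases lt_trichotomy α β with h' | h' | h' <;>
    simp [h, h', h.not_gt, h'.not_gt, pderiv_X, Pi.single_apply] <;> grind

/-- The matrix of the symbols of the operators `∂_{μν}`. -/
noncomputable def symbolMatrix (n : ℕ) : Matrix (Fin n) (Fin n) (PolyH n) := Matrix.of xv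

/-- The operator `-ad` of the matrix of symbols. -/
noncomputable def negAdSymbol (n : ℕ) : Module.End ℝ (Matrix (Fin n) (Fin n) (PolyH n)) :=
  LinearMap.mulRight ℝ (symbolMatrix n) - LinearMap.mulLeft ℝ (symbolMatrix n)

lemma negAdSymbol_apply (V : Matrix (Fin n) (Fin n) (PolyH n)) :
    negAdSymbol n V = V * symbolMatrix n - symbolMatrix n * V := rfl

lemma negAdSymbol_lie (A B : Matrix (Fin n) (Fin n) (PolyH n)) :
    negAdSymbol n ⁅A, B⁆ = ⁅negAdSymbol n A, B⁆ + ⁅A, negAdSymbol n B⁆ := by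
  simp only [negAdSymbol_apply, Ring.lie_def]
  noncomm_ring

lemma negAdSymbol_pow_smul (k : ℕ) (f : PolyH n) (V : Matrix (Fin n) (Fin n) (PolyH n)) :
    (negAdSymbol n ^ k) (f • V) = f • (negAdSymbol n ^ k) V := by
  induction k with
  | zero => simp
  | succ k ih =>
    rw [pow_succ', Module.End.mul_apply, Module.End.mul_apply, ih, negAdSymbol_apply,
      negAdSymbol_apply, smul_sub, Matrix.smul_mul, Matrix.mul_smul]

lemma transpose_negAdSymbol_pow {A : Matrix (Fin n) (Fin n) (PolyH n)} (hA : A.transpose = -A)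
    (k : ℕ) : ((negAdSymbol n ^ k) A).transpose = -(negAdSymbol n ^ k) A := by
  have hD : (symbolMatrix n).transpose = -symbolMatrix n := by
    refine Matrix.ext fun i j => ?_
    exact xv_swap i j
  induction k with
  | zero => simpa using hA
  | succ k ih =>
    rw [pow_succ', Module.End.mul_apply, negAdSymbol_apply, Matrix.transpose_sub,
      Matrix.transpose_mul, Matrix.transpose_mul, ih, hD]
    noncomm_ring

lemma kd_comm (a b : Fin n) : kd a b = kd b a := by
  simp only [kd, eq_comm]

lemma sum_kd_smul {M : Type*} [AddCommGroup M] [Module ℝ M] (a : Fin n) (f : Fin n → M) :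
    ∑ b, kd a b • f b = f a := by
  simp [kd, ite_smul]

lemma single_mul_single_kd (a b c d : Fin n) :
    (Matrix.single a b 1 * Matrix.single c d 1 : Matrix (Fin n) (Fin n) (PolyH n)) =
      kd b c • Matrix.single a d 1 := by
  unfold kd
  split_ifs with h
  · subst h
    rw [Matrix.single_mul_single_same, one_smul, mul_one]
  · rw [Matrix.single_mul_single_of_ne _ _ _ _ h, zero_smul]

/-- The antisymmetrized matrix unit, the row `(μν)` of `K⁰`. -/
noncomputable def skewUnit (μ ν : Fin n) : Matrix (Fin n) (Fin n) (PolyH n) :=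
  (1 / 2 : ℝ) • (Matrix.single μ ν 1 - Matrix.single ν μ 1)

lemma skewUnit_apply (μ ν α β : Fin n) :
    skewUnit μ ν α β = C (1 / 2 * (kd μ α * kd ν β - kd μ β * kd ν α)) := by
  have h : ∀ a b c d : Fin n,
      (if a = b ∧ c = d then 1 else 0 : PolyH n) = C (kd a b * kd c d) := by
    intro a b c d
    by_cases hab : a = b <;> by_cases hcd : c = d <;> simp [kd, hab, hcd]
  rw [skewUnit, Matrix.smul_apply, Matrix.sub_apply, Matrix.single_apply, Matrix.single_apply,
    h, h, smul_eq_C_mul, ← C_sub, ← C_mul, mul_comm (kd ν α)]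

lemma transpose_skewUnit (μ ν : Fin n) : (skewUnit μ ν).transpose = -skewUnit μ ν := by
  refine Matrix.ext fun i j => ?_
  rw [Matrix.transpose_apply, Matrix.neg_apply, skewUnit_apply, skewUnit_apply, ← map_neg]
  congr 1
  ring

lemma two_smul_lie_skewUnit (μ ν lam ρ : Fin n) :
    (2 : ℝ) • ⁅skewUnit μ ν, skewUnit lam ρ⁆ =
      kd ν lam • skewUnit μ ρ - kd μ lam • skewUnit ν ρ - kd ν ρ • skewUnit μ lam +
        kd μ ρ • skewUnit ν lam := by
  simp only [skewUnit, Ring.lie_def, smul_mul_smul_comm, sub_mul, mul_sub, single_mul_single_kd,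
    kd_comm lam, kd_comm ρ]
  module

/-- The symbol of `Kop`. -/
noncomputable def kSymbol (μ ν α β : Fin n) : PolyH n :=
  (1 / 2 : ℝ) • (kd μ α • xv ν β - kd μ β • xv ν α + kd ν β • xv μ α - kd ν α • xv μ β)

lemma Kop_eq_constCoeffOp (μ ν α β : Fin n) (p : PolyH n) :
    Kop μ ν α β p = constCoeffOp _ (kSymbol μ ν α β) p := by
  simp only [Kop, kSymbol, map_smul, map_sub, map_add, LinearMap.smul_apply,
    LinearMap.sub_apply, LinearMap.add_apply, constCoeffOp_xv]

lemma sum_kSymbol_smul_skewUnit (μ ν : Fin n) :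
    ∑ θ, ∑ σ, kSymbol μ ν θ σ • skewUnit θ σ = negAdSymbol n (skewUnit μ ν) := by
  refine Matrix.ext fun α β => ?_
  simp only [negAdSymbol_apply, Matrix.sub_apply, Matrix.mul_apply, Matrix.sum_apply,
    Matrix.smul_apply, skewUnit_apply, symbolMatrix, Matrix.of_apply, smul_eq_mul,
    mul_comm _ (C _), ← smul_eq_C_mul, sub_smul, mul_sub, Finset.sum_sub_distrib, mul_smul]
  simp only [kd_comm _ α, kd_comm _ β, ← Finset.smul_sum, sum_kd_smul, kSymbol,
    xv_swap β, xv_swap α μ, xv_swap α ν]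
  module

lemma Kpow_eq_constCoeffOp (k : ℕ) (μ ν α β : Fin n) (p : PolyH n) :
    Kpow k μ ν α β p = constCoeffOp _ ((negAdSymbol n ^ k) (skewUnit μ ν) α β) p := by
  induction k generalizing μ ν with
  | zero => rw [pow_zero, Module.End.one_apply, skewUnit_apply, constCoeffOp_C, Kpow]
  | succ k ih =>
    rw [pow_succ, Module.End.mul_apply, ← sum_kSymbol_smul_skewUnit]
    simp only [Kpow, ih, Kop_eq_constCoeffOp, map_sum, negAdSymbol_pow_smul, Matrix.sum_apply,
      Matrix.smul_apply, smul_eq_mul, LinearMap.sum_apply, constCoeffOp_mul_apply]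

/-- The operator `∑ x_{αβ} V_{αβ}(∂)`. -/
noncomputable def weylOp (n : ℕ) :
    Matrix (Fin n) (Fin n) (PolyH n) →ₗ[ℝ] Module.End ℝ (PolyH n) :=
  ∑ a : Fin n × Fin n, LinearMap.mulLeft ℝ (LinearMap.mulLeft ℝ (xv a.1 a.2)) ∘ₗ
    (constCoeffOp _).toLinearMap ∘ₗ Matrix.entryLinearMap ℝ (PolyH n) a.1 a.2

lemma weylOp_apply (V : Matrix (Fin n) (Fin n) (PolyH n)) (p : PolyH n) :
    weylOp n V p = ∑ a : Fin n × Fin n, xv a.1 a.2 * constCoeffOp _ (V a.1 a.2) p := by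
  simp [weylOp, LinearMap.sum_apply]

/-- The derivation `∑ W_{γδ} ∂_{γδ}`. -/
noncomputable def dirDeriv (W : Matrix (Fin n) (Fin n) (PolyH n)) :
    Derivation ℝ (PolyH n) (PolyH n) :=
  ∑ a : Fin n × Fin n, W a.1 a.2 • dder a.1 a.2

lemma dirDeriv_apply (W : Matrix (Fin n) (Fin n) (PolyH n)) (f : PolyH n) :
    dirDeriv W f = ∑ a : Fin n × Fin n, W a.1 a.2 * dder a.1 a.2 f := by
  rw [dirDeriv, ← Derivation.coeFnAddMonoidHom_apply, map_sum, Finset.sum_apply]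
  rfl

lemma weylOp_weylOp (V W : Matrix (Fin n) (Fin n) (PolyH n)) (p : PolyH n) :
    weylOp n V (weylOp n W p) =
      ∑ a : Fin n × Fin n, ∑ b : Fin n × Fin n, xv a.1 a.2 * xv b.1 b.2 *
          constCoeffOp _ (V a.1 a.2 * W b.1 b.2) p +
        weylOp n (V.map (dirDeriv W)) p := by
  simp only [weylOp_apply, map_sum, Finset.mul_sum, Matrix.map_apply, dirDeriv_apply,
    LinearMap.sum_apply, constCoeffOp_xv_mul, ← Finset.sum_add_distrib]
  rw [Finset.sum_comm]
  refine Finset.sum_congr rfl fun a _ => Finset.sum_congr rfl fun b _ => ?_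
  rw [mul_comm (W b.1 b.2), constCoeffOp_mul_apply, constCoeffOp_mul_apply]
  ring

lemma weylOp_commutator (V W : Matrix (Fin n) (Fin n) (PolyH n)) (p : PolyH n) :
    weylOp n V (weylOp n W p) - weylOp n W (weylOp n V p) =
      weylOp n (V.map (dirDeriv W) - W.map (dirDeriv V)) p := by
  have h : ∑ a : Fin n × Fin n, ∑ b : Fin n × Fin n, xv a.1 a.2 * xv b.1 b.2 *
        constCoeffOp _ (V a.1 a.2 * W b.1 b.2) p =
      ∑ a : Fin n × Fin n, ∑ b : Fin n × Fin n, xv a.1 a.2 * xv b.1 b.2 *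
        constCoeffOp _ (W a.1 a.2 * V b.1 b.2) p := by
    rw [Finset.sum_comm]
    refine Finset.sum_congr rfl fun a _ => Finset.sum_congr rfl fun b _ => ?_
    rw [mul_comm (xv b.1 b.2), mul_comm (V b.1 b.2)]
  rw [weylOp_weylOp, weylOp_weylOp, h, map_sub, LinearMap.sub_apply]
  ring

lemma map_derivation_mul (δ : Derivation ℝ (PolyH n) (PolyH n))
    (A B : Matrix (Fin n) (Fin n) (PolyH n)) :
    (A * B).map δ = A.map δ * B + A * B.map δ := by
  refine Matrix.ext fun i j => ?_
  simp only [Matrix.map_apply, Matrix.add_apply, Matrix.mul_apply, map_sum, Derivation.leibniz,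
    smul_eq_mul, ← Finset.sum_add_distrib]
  exact Finset.sum_congr rfl fun k _ => by ring

lemma map_dirDeriv_symbolMatrix (W : Matrix (Fin n) (Fin n) (PolyH n)) :
    (symbolMatrix n).map (dirDeriv W) = W - W.transpose := by
  refine Matrix.ext fun α β => ?_
  rw [Matrix.map_apply, symbolMatrix, Matrix.of_apply, dirDeriv_apply, Fintype.sum_prod_type]
  simp only [dder_xv, mul_comm _ (C _), ← smul_eq_C_mul, sub_smul, Finset.sum_sub_distrib, mul_smul,
    kd_comm _ α, kd_comm _ β, ← Finset.smul_sum, sum_kd_smul]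
  rfl

lemma map_dirDeriv_negAdSymbol {W : Matrix (Fin n) (Fin n) (PolyH n)} (hW : W.transpose = -W)
    (V : Matrix (Fin n) (Fin n) (PolyH n)) :
    (negAdSymbol n V).map (dirDeriv W) =
      negAdSymbol n (V.map (dirDeriv W)) + (2 : ℝ) • ⁅V, W⁆ := by
  rw [negAdSymbol_apply, Matrix.map_sub _ (map_sub _), map_derivation_mul, map_derivation_mul,
    map_dirDeriv_symbolMatrix, hW, negAdSymbol_apply, Ring.lie_def, two_smul]
  noncomm_ring

lemma map_dirDeriv_negAdSymbol_pow {A W : Matrix (Fin n) (Fin n) (PolyH n)}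
    (hW : W.transpose = -W) (hA : A.map (dirDeriv W) = 0) (k : ℕ) :
    ((negAdSymbol n ^ k) A).map (dirDeriv W) = (2 : ℝ) • ∑ i ∈ Finset.range k,
      (negAdSymbol n ^ i) ⁅(negAdSymbol n ^ (k - 1 - i)) A, W⁆ := by
  induction k with
  | zero => simpa using hA
  | succ k ih =>
    rw [pow_succ', Module.End.mul_apply, map_dirDeriv_negAdSymbol hW, ih,
      Finset.sum_range_succ', map_smul, map_sum, smul_add]
    congr 2
    refine Finset.sum_congr rfl fun i _ => ?_
    rw [pow_succ', Module.End.mul_apply, Nat.add_sub_cancel, Nat.sub_sub, add_comm 1 i]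

lemma map_derivation_skewUnit (δ : Derivation ℝ (PolyH n) (PolyH n)) (μ ν : Fin n) :
    (skewUnit μ ν).map δ = 0 := by
  refine Matrix.ext fun i j => ?_
  rw [Matrix.map_apply, skewUnit_apply, Matrix.zero_apply, ← algebraMap_eq,
    Derivation.map_algebraMap]

/-- The bidegree `(k, l)` part of the symbol of half the commutator of two Weyl operators. -/
noncomputable def lieSymbol (k l : ℕ) (A B : Matrix (Fin n) (Fin n) (PolyH n)) :
    Matrix (Fin n) (Fin n) (PolyH n) :=
  (∑ i ∈ Finset.range k,
      (negAdSymbol n ^ i) ⁅(negAdSymbol n ^ (k - 1 - i)) A, (negAdSymbol n ^ l) B⁆) +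
    ∑ i ∈ Finset.range l,
      (negAdSymbol n ^ i) ⁅(negAdSymbol n ^ k) A, (negAdSymbol n ^ (l - 1 - i)) B⁆

lemma weylOp_commutator_skewUnit (k l : ℕ) (μ ν lam ρ : Fin n) (p : PolyH n) :
    weylOp n ((negAdSymbol n ^ k) (skewUnit μ ν))
        (weylOp n ((negAdSymbol n ^ l) (skewUnit lam ρ)) p) -
      weylOp n ((negAdSymbol n ^ l) (skewUnit lam ρ))
        (weylOp n ((negAdSymbol n ^ k) (skewUnit μ ν)) p) =
      (2 : ℝ) • weylOp n (lieSymbol k l (skewUnit μ ν) (skewUnit lam ρ)) p := by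
  have hs : ∀ i, (negAdSymbol n ^ i)
        ⁅(negAdSymbol n ^ (l - 1 - i)) (skewUnit lam ρ), (negAdSymbol n ^ k) (skewUnit μ ν)⁆ =
      -(negAdSymbol n ^ i)
        ⁅(negAdSymbol n ^ k) (skewUnit μ ν), (negAdSymbol n ^ (l - 1 - i)) (skewUnit lam ρ)⁆ :=
    fun i => by rw [← map_neg, Ring.lie_def, Ring.lie_def, neg_sub]
  rw [weylOp_commutator,
    map_dirDeriv_negAdSymbol_pow (transpose_negAdSymbol_pow (transpose_skewUnit lam ρ) l)
      (map_derivation_skewUnit _ μ ν),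
    map_dirDeriv_negAdSymbol_pow (transpose_negAdSymbol_pow (transpose_skewUnit μ ν) k)
      (map_derivation_skewUnit _ lam ρ), ← smul_sub, map_smul, LinearMap.smul_apply, lieSymbol]
  simp only [hs, Finset.sum_neg_distrib, sub_neg_eq_add]

/-- All entries are homogeneous of degree `d`. -/
def IsHomogeneousMatrix (V : Matrix (Fin n) (Fin n) (PolyH n)) (d : ℕ) : Prop :=
  ∀ i j, (V i j).IsHomogeneous d

lemma IsHomogeneousMatrix.mul {V W : Matrix (Fin n) (Fin n) (PolyH n)} {d e : ℕ}
    (hV : IsHomogeneousMatrix V d) (hW : IsHomogeneousMatrix W e) :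
    IsHomogeneousMatrix (V * W) (d + e) := fun i j => by
  rw [Matrix.mul_apply]
  exact IsHomogeneous.sum _ _ _ fun k _ => (hV i k).mul (hW k j)

lemma IsHomogeneousMatrix.lie {V W : Matrix (Fin n) (Fin n) (PolyH n)} {d e : ℕ}
    (hV : IsHomogeneousMatrix V d) (hW : IsHomogeneousMatrix W e) :
    IsHomogeneousMatrix ⁅V, W⁆ (d + e) := fun i j =>
  (hV.mul hW i j).sub (add_comm e d ▸ hW.mul hV i j)

lemma IsHomogeneousMatrix.negAdSymbol_pow {V : Matrix (Fin n) (Fin n) (PolyH n)} {d : ℕ}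
    (hV : IsHomogeneousMatrix V d) (k : ℕ) :
    IsHomogeneousMatrix ((negAdSymbol n ^ k) V) (d + k) := by
  induction k with
  | zero => exact hV
  | succ k ih =>
    rw [pow_succ', Module.End.mul_apply]
    exact ih.lie fun i j => isHomogeneous_xv i j

lemma isHomogeneousMatrix_skewUnit (μ ν : Fin n) : IsHomogeneousMatrix (skewUnit μ ν) 0 :=
  fun i j => by rw [skewUnit_apply]; exact isHomogeneous_C _ _

lemma IsHomogeneousMatrix.lieSymbol {A B : Matrix (Fin n) (Fin n) (PolyH n)}
    (hA : IsHomogeneousMatrix A 0) (hB : IsHomogeneousMatrix B 0) (k l : ℕ) :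
    IsHomogeneousMatrix (lieSymbol k l A B) (k + l - 1) := by
  intro i j
  rw [_root_.lieSymbol, Matrix.add_apply, Matrix.sum_apply, Matrix.sum_apply]
  refine (IsHomogeneous.sum _ _ _ fun r hr => ?_).add (IsHomogeneous.sum _ _ _ fun r hr => ?_)
  · have := Finset.mem_range.1 hr
    have h := ((hA.negAdSymbol_pow (k - 1 - r)).lie (hB.negAdSymbol_pow l)).negAdSymbol_pow r i j
    convert h using 1
    omega
  · have := Finset.mem_range.1 hr
    have h := ((hA.negAdSymbol_pow k).lie (hB.negAdSymbol_pow (l - 1 - r))).negAdSymbol_pow r i j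
    convert h using 1
    omega

lemma weylOp_of_totalDegree_lt {V : Matrix (Fin n) (Fin n) (PolyH n)} {d : ℕ}
    (hV : IsHomogeneousMatrix V d) {p : PolyH n} (hp : p.totalDegree < d) :
    weylOp n V p = 0 := by
  rw [weylOp_apply]
  exact Finset.sum_eq_zero fun a _ => by
    rw [constCoeffOp_of_totalDegree_lt (hV a.1 a.2) hp, mul_zero]

lemma Mhat_eq_sum {N : ℕ} {p : PolyH n} (hp : p.totalDegree < N) (μ ν : Fin n) :
    Mhat μ ν p =
      ∑ k ∈ Finset.range N, bcoef k • weylOp n ((negAdSymbol n ^ k) (skewUnit μ ν)) p := by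
  have hpsi : ∀ α β, psiK μ ν α β p = ∑ k ∈ Finset.range N,
      bcoef k • constCoeffOp _ ((negAdSymbol n ^ k) (skewUnit μ ν) α β) p := by
    intro α β
    simp only [psiK, Kpow_eq_constCoeffOp]
    refine finsum_eq_sum_of_support_subset _ fun k hk => ?_
    by_contra hkN
    have hkN : N ≤ k := by simpa using hkN
    refine hk ?_
    have hV := (isHomogeneousMatrix_skewUnit μ ν).negAdSymbol_pow k
    have h0 := constCoeffOp_of_totalDegree_lt (hV α β) (p := p) (by omega)
    exact (congrArg (bcoef k • ·) h0).trans (smul_zero _)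
  simp only [Mhat, hpsi, weylOp_apply, Finset.mul_sum, Finset.smul_sum, mul_smul_comm]
  rw [← Fintype.sum_prod_type' (f := fun α β => ∑ k ∈ Finset.range N,
    bcoef k • (xv α β * constCoeffOp _ ((negAdSymbol n ^ k) (skewUnit μ ν) α β) p)),
    Finset.sum_comm]

lemma sum_range_mul_range_eq_sum_antidiagonal {M : Type*} [AddCommMonoid M] (f : ℕ → ℕ → M)
    (N : ℕ) (hf : ∀ k l, N ≤ k + l → f k l = 0) :
    ∑ k ∈ Finset.range N, ∑ l ∈ Finset.range N, f k l =
      ∑ m ∈ Finset.range N, ∑ kl ∈ Finset.HasAntidiagonal.antidiagonal m, f kl.1 kl.2 := by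
  simp only [Finset.Nat.sum_antidiagonal_eq_sum_range_succ f]
  rw [Finset.sum_range_diag_flip]
  refine Finset.sum_congr rfl fun k _ => (Finset.sum_subset ?_ fun l _ hl => hf k l ?_).symm
  · exact Finset.range_subset_range.2 (Nat.sub_le N k)
  · have := mt Finset.mem_range.2 hl
    omega

lemma sum_bcoef_weylOp_commutator {N : ℕ} {p : PolyH n} (hp : p.totalDegree < N)
    (μ ν lam ρ : Fin n) :
    ∑ k ∈ Finset.range (N + 1), ∑ l ∈ Finset.range (N + 1), (bcoef k * bcoef l) •
        weylOp n (lieSymbol k l (skewUnit μ ν) (skewUnit lam ρ)) p =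
      ∑ m ∈ Finset.range N,
        bcoef m • weylOp n ((negAdSymbol n ^ m) ⁅skewUnit μ ν, skewUnit lam ρ⁆) p := by
  rw [sum_range_mul_range_eq_sum_antidiagonal (fun k l => (bcoef k * bcoef l) •
    weylOp n (lieSymbol k l (skewUnit μ ν) (skewUnit lam ρ)) p), Finset.sum_range_succ']
  · rw [Finset.Nat.antidiagonal_zero, Finset.sum_singleton]
    have h0 : lieSymbol 0 0 (skewUnit μ ν) (skewUnit lam ρ) = 0 := by simp [lieSymbol]
    rw [h0, map_zero, LinearMap.zero_apply, smul_zero, add_zero]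
    refine Finset.sum_congr rfl fun m _ => ?_
    have h := congrArg (fun V => weylOp n V p)
      (bcoef_bracket_addition negAdSymbol_lie (skewUnit μ ν) (skewUnit lam ρ) m)
    simpa only [map_sum, map_smul, LinearMap.sum_apply, LinearMap.smul_apply, lieSymbol] using h
  · intro k l hkl
    rw [weylOp_of_totalDegree_lt ((isHomogeneousMatrix_skewUnit μ ν).lieSymbol
      (isHomogeneousMatrix_skewUnit lam ρ) k l) (by omega), smul_zero]

end Weyl

/-- the operators `M̂_{μν}` satisfy the `so(n)` commutation relations. -/
theorem statement13 (n : ℕ) (hn : 2 ≤ n) (μ ν lam ρ : Fin n) :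
    Mhat μ ν ∘ Mhat lam ρ - Mhat lam ρ ∘ Mhat μ ν
      = kd ν lam • Mhat μ ρ - kd μ lam • Mhat ν ρ - kd ν ρ • Mhat μ lam + kd μ ρ • Mhat ν lam := by
  funext p
  simp only [Pi.sub_apply, Pi.add_apply, Pi.smul_apply, Function.comp_apply]
  obtain ⟨N, h0, h1, h2⟩ : ∃ N, p.totalDegree < N ∧ (Mhat μ ν p).totalDegree < N ∧
      (Mhat lam ρ p).totalDegree < N :=
    ⟨p.totalDegree + (Mhat μ ν p).totalDegree + (Mhat lam ρ p).totalDegree + 1,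
      by omega, by omega, by omega⟩
  rw [Mhat_eq_sum (Nat.lt_succ_of_lt h2) μ ν, Mhat_eq_sum (Nat.lt_succ_of_lt h1) lam ρ,
    Mhat_eq_sum (Nat.lt_succ_of_lt h0) μ ν, Mhat_eq_sum (Nat.lt_succ_of_lt h0) lam ρ,
    Mhat_eq_sum h0 μ ρ, Mhat_eq_sum h0 ν ρ, Mhat_eq_sum h0 μ lam, Mhat_eq_sum h0 ν lam]
  have hR : ∑ m ∈ Finset.range N, bcoef m • weylOp n ((negAdSymbol n ^ m)
      ((2 : ℝ) • ⁅skewUnit μ ν, skewUnit lam ρ⁆)) p = (2 : ℝ) • ∑ m ∈ Finset.range N,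
        bcoef m • weylOp n ((negAdSymbol n ^ m) ⁅skewUnit μ ν, skewUnit lam ρ⁆) p := by
    simp only [map_smul, LinearMap.smul_apply, Finset.smul_sum, smul_comm (2 : ℝ)]
  rw [← sum_bcoef_weylOp_commutator h0, two_smul_lie_skewUnit] at hR
  have hL : ∀ k l, (2 : ℝ) • (bcoef k * bcoef l) •
      weylOp n (lieSymbol k l (skewUnit μ ν) (skewUnit lam ρ)) p =
        bcoef k • bcoef l • weylOp n ((negAdSymbol n ^ k) (skewUnit μ ν))
          (weylOp n ((negAdSymbol n ^ l) (skewUnit lam ρ)) p) -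
        bcoef k • bcoef l • weylOp n ((negAdSymbol n ^ l) (skewUnit lam ρ))
          (weylOp n ((negAdSymbol n ^ k) (skewUnit μ ν)) p) := by
    intro k l
    rw [smul_comm, ← weylOp_commutator_skewUnit, smul_smul, smul_smul, smul_sub]
  simp only [Finset.smul_sum, hL, map_sub, map_add, map_smul, LinearMap.sub_apply,
    LinearMap.add_apply, LinearMap.smul_apply, smul_sub, smul_add, Finset.sum_sub_distrib,
    Finset.sum_add_distrib, map_sum] at hR ⊢
  rw [Finset.sum_comm (s := Finset.range (N + 1)) (f := fun k l => bcoef k • bcoef l •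
    weylOp n ((negAdSymbol n ^ l) (skewUnit lam ρ))
          (weylOp n ((negAdSymbol n ^ k) (skewUnit μ ν)) p))] at hR
  simp only [smul_comm (kd _ _) (bcoef _)]
  rw [hR]
  exact congrArg _ (Finset.sum_congr rfl fun l _ => Finset.sum_congr rfl fun k _ =>
    smul_comm _ _ _)
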